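/- arXiv:2411.16564 — 2 statements merged into one kernel-verified Lean document; each statement's English description precedes it below -/
import Mathlib

section
/- Let M = (S, Act, P) be an MDP and rew : S → [0,∞] a reward function for M. There exists a memoryless scheduler 𝔖 that is uniformly min-optimal for M with respect to rew, i.e. for every state s ∈ S, ER_𝔖(rew, s) = MinER(rew, s). -/
open scoped ENNReal

noncomputable section

/-- A Markov decision process: countable state space `S`, finite action set `A`,
transition probability function `P` (values in `[0,1]`, represented in `ℝ≥0∞`)
such that each `P s a ·` is a finitely supported full or null distribution,
and every state has at least one enabled action. -/
structure MDP where
  S : Type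
  A : Type
  countableS : Countable S
  finiteA : Finite A
  P : S → A → S → ℝ≥0∞
  P_le_one : ∀ s a s', P s a s' ≤ 1
  finite_supp : ∀ s a, {s' | 0 < P s a s'}.Finite
  full_or_null : ∀ s a, (∑' s', P s a s') = 1 ∨ (∑' s', P s a s') = 0
  exists_enabled : ∀ s, ∃ a, (∑' s', P s a s') = 1

/-- Reward of a path: sum of the rewards of all its states. -/
def rewPath {σ : Type*} (rew : σ → ℝ≥0∞) (π : List σ) : ℝ≥0∞ := (π.map rew).sum

/-- Reward of the last state of a path (zero for the empty sequence). -/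
def lastRew {σ : Type*} (rew : σ → ℝ≥0∞) (π : List σ) : ℝ≥0∞ := π.getLast?.elim 0 rew

/-- Knaster–Tarski least fixed point of an endomap on a complete lattice. -/
def lfpOf {α : Type*} [CompleteLattice α] (Φ : α → α) : α := sInf {v | Φ v ≤ v}

namespace MDP

/-- The set of actions enabled in state `s`. -/
def Act (M : MDP) (s : M.S) : Set M.A := {a | (∑' s', M.P s a s') = 1}

/-- A scheduler assigns to every history (coded as the list of previously visited
states together with the current state; `𝔖 h s` is the choice for history `h ++ [s]`)
an action enabled in the current state. -/
def IsSched (M : MDP) (𝔖 : List M.S → M.S → M.A) : Prop :=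
  ∀ (h : List M.S) (s : M.S), 𝔖 h s ∈ M.Act s

/-- A scheduler is memoryless if its choice depends only on the last state. -/
def Memoryless (M : MDP) (𝔖 : List M.S → M.S → M.A) : Prop :=
  ∀ (h₁ h₂ : List M.S) (s : M.S), 𝔖 h₁ s = 𝔖 h₂ s

/-- The type of schedulers of `M`. -/
def Scheds (M : MDP) : Type := {𝔖 : List M.S → M.S → M.A // M.IsSched 𝔖}

/-- A path is a finite nonempty sequence of states such that each step is
possible via some enabled action. -/
def IsPath (M : MDP) : List M.S → Prop
  | [] => False
  | [_] => True
  | s :: s' :: rest => (∃ a ∈ M.Act s, 0 < M.P s a s') ∧ IsPath M (s' :: rest)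

/-- Probability of traversing the given remaining path, where `pref` is the
history of previously visited states. -/
def probAux (M : MDP) (𝔖 : List M.S → M.S → M.A) : List M.S → List M.S → ℝ≥0∞
  | _, [] => 1
  | _, [_] => 1
  | pref, s :: s' :: rest =>
      M.P s (𝔖 pref s) s' * probAux M 𝔖 (pref ++ [s]) (s' :: rest)

/-- The probability of a path under scheduler `𝔖` (the empty product is `1`). -/
def pathProb (M : MDP) (𝔖 : List M.S → M.S → M.A) (π : List M.S) : ℝ≥0∞ :=
  M.probAux 𝔖 [] π

/-- Paths of length exactly `n` (that is, `n` steps and `n + 1` states) starting in `s`. -/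
def PathsEq (M : MDP) (n : ℕ) (s : M.S) : Set (List M.S) :=
  {π | M.IsPath π ∧ π.head? = some s ∧ π.length = n + 1}

/-- Paths of length at most `n` starting in `s`. -/
def PathsLe (M : MDP) (n : ℕ) (s : M.S) : Set (List M.S) :=
  {π | M.IsPath π ∧ π.head? = some s ∧ π.length ≤ n + 1}

/-- All finite paths starting in `s`. -/
def Paths (M : MDP) (s : M.S) : Set (List M.S) :=
  {π | M.IsPath π ∧ π.head? = some s}

/-- Expected reward from `s` after exactly `n` steps under scheduler `𝔖`. -/
def ERn (M : MDP) (rew : M.S → ℝ≥0∞) (𝔖 : List M.S → M.S → M.A) (n : ℕ) (s : M.S) :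
    ℝ≥0∞ :=
  ∑' π : M.PathsEq n s, M.pathProb 𝔖 (π : List M.S) * rewPath rew (π : List M.S)

/-- Total expected reward from `s` under scheduler `𝔖`. -/
def ER (M : MDP) (rew : M.S → ℝ≥0∞) (𝔖 : List M.S → M.S → M.A) (s : M.S) : ℝ≥0∞ :=
  ⨆ n : ℕ, M.ERn rew 𝔖 n s

/-- Minimal expected reward from `s` after exactly `n` steps. -/
def MinERn (M : MDP) (rew : M.S → ℝ≥0∞) (n : ℕ) (s : M.S) : ℝ≥0∞ :=
  ⨅ 𝔖 : M.Scheds, M.ERn rew 𝔖.1 n s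

/-- Maximal expected reward from `s` after exactly `n` steps. -/
def MaxERn (M : MDP) (rew : M.S → ℝ≥0∞) (n : ℕ) (s : M.S) : ℝ≥0∞ :=
  ⨆ 𝔖 : M.Scheds, M.ERn rew 𝔖.1 n s

/-- Minimal (total) expected reward from `s`. -/
def MinER (M : MDP) (rew : M.S → ℝ≥0∞) (s : M.S) : ℝ≥0∞ :=
  ⨅ 𝔖 : M.Scheds, M.ER rew 𝔖.1 s

/-- Maximal (total) expected reward from `s`. -/
def MaxER (M : MDP) (rew : M.S → ℝ≥0∞) (s : M.S) : ℝ≥0∞ :=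
  ⨆ 𝔖 : M.Scheds, M.ER rew 𝔖.1 s

/-- The min-Bellman operator of `M` with respect to `rew`. -/
def bellmanMin (M : MDP) (rew : M.S → ℝ≥0∞) (v : M.S → ℝ≥0∞) : M.S → ℝ≥0∞ :=
  fun s => rew s + ⨅ a : M.Act s, ∑' s', M.P s a.1 s' * v s'

/-- The max-Bellman operator of `M` with respect to `rew`. -/
def bellmanMax (M : MDP) (rew : M.S → ℝ≥0∞) (v : M.S → ℝ≥0∞) : M.S → ℝ≥0∞ :=
  fun s => rew s + ⨆ a : M.Act s, ∑' s', M.P s a.1 s' * v s'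

end MDP

namespace MDP

variable (M : MDP) (rew : M.S → ℝ≥0∞)

instance (s : M.S) : Finite (M.Act s) :=
  haveI := M.finiteA
  inferInstance

instance (s : M.S) : Nonempty (M.Act s) :=
  let ⟨a, ha⟩ := M.exists_enabled s
  ⟨⟨a, ha⟩⟩

/-- Expectation of `f` over the paths with `n` steps from `s`, when the history `h` has already
been traversed. -/
def pathExp (𝔖 : List M.S → M.S → M.A) (f : List M.S → ℝ≥0∞) (n : ℕ) (h : List M.S)
    (s : M.S) : ℝ≥0∞ :=
  ∑' π : M.PathsEq n s, M.probAux 𝔖 h (π : List M.S) * f (π : List M.S)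

variable {M}

lemma pathsEq_zero (s : M.S) : M.PathsEq 0 s = {[s]} := by
  ext π
  match π with
  | [] => simp [PathsEq]
  | [t] => simp [PathsEq, IsPath]
  | t :: u :: r => simp [PathsEq]

lemma pathExp_zero (𝔖 : List M.S → M.S → M.A) (f : List M.S → ℝ≥0∞) (h : List M.S) (s : M.S) :
    M.pathExp 𝔖 f 0 h s = f [s] := by
  rw [pathExp, pathsEq_zero, tsum_singleton [s] fun π => M.probAux 𝔖 h π * f π]
  simp [probAux]

lemma exists_of_mem_pathsEq_succ {n : ℕ} {s : M.S} {π : List M.S}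
    (hπ : π ∈ M.PathsEq (n + 1) s) : ∃ t, π.tail ∈ M.PathsEq n t := by
  match π, hπ with
  | [_], ⟨_, _, hl⟩ => simp at hl
  | _ :: t :: r, ⟨hp, _, hl⟩ => exact ⟨t, hp.2, rfl, by simpa using hl⟩

lemma cons_mem_pathsEq_succ {n : ℕ} {s t : M.S} {π : List M.S} (hπ : π ∈ M.PathsEq n t)
    {a : M.A} (ha : a ∈ M.Act s) (hP : 0 < M.P s a t) : s :: π ∈ M.PathsEq (n + 1) s := by
  match π, hπ with
  | u :: r, ⟨hp, hh, hl⟩ =>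
    obtain rfl : u = t := by simpa using hh
    exact ⟨⟨⟨a, ha, hP⟩, hp⟩, rfl, by simpa using hl⟩

lemma probAux_cons {n : ℕ} {t : M.S} {π : List M.S} (hπ : π ∈ M.PathsEq n t)
    (𝔖 : List M.S → M.S → M.A) (h : List M.S) (s : M.S) :
    M.probAux 𝔖 h (s :: π) = M.P s (𝔖 h s) t * M.probAux 𝔖 (h ++ [s]) π := by
  match π, hπ with
  | u :: r, ⟨_, hh, _⟩ =>
    obtain rfl : u = t := by simpa using hh
    rfl

lemma pathExp_succ {𝔖 : List M.S → M.S → M.A} (h𝔖 : M.IsSched 𝔖) (f : List M.S → ℝ≥0∞) (n : ℕ)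
    (h : List M.S) (s : M.S) :
    M.pathExp 𝔖 f (n + 1) h s =
      ∑' t, M.P s (𝔖 h s) t * M.pathExp 𝔖 (fun π => f (s :: π)) n (h ++ [s]) t := by
  have cons_tail : ∀ π : M.PathsEq (n + 1) s, s :: (π : List M.S).tail = π := by
    rintro ⟨π, _, hh, _⟩
    match π, hh with
    | u :: r, hh => simpa using hh.symm
  choose t ht using fun π : M.PathsEq (n + 1) s => exists_of_mem_pathsEq_succ π.2
  let g : M.PathsEq (n + 1) s → Σ u, M.PathsEq n u := fun π => ⟨t π, (π : List M.S).tail, ht π⟩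
  let F : (Σ u, M.PathsEq n u) → ℝ≥0∞ := fun x =>
    M.P s (𝔖 h s) x.1 * (M.probAux 𝔖 (h ++ [s]) x.2 * f (s :: x.2))
  have hg : Function.Injective g := by
    intro π ρ hπρ
    have htail : (π : List M.S).tail = (ρ : List M.S).tail :=
      congrArg (fun x : Σ u, M.PathsEq n u => (x.2 : List M.S)) hπρ
    exact Subtype.ext (by rw [← cons_tail π, ← cons_tail ρ, htail])
  have hsupp : Function.support F ⊆ Set.range g := by
    rintro ⟨u, π, hπ⟩ hx
    have hP : 0 < M.P s (𝔖 h s) u := pos_iff_ne_zero.2 (left_ne_zero_of_mul hx)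
    let ρ : M.PathsEq (n + 1) s := ⟨s :: π, cons_mem_pathsEq_succ hπ (h𝔖 h s) hP⟩
    exact ⟨ρ, Sigma.subtype_ext (p := fun u π => π ∈ M.PathsEq n u)
      (Option.some.inj ((ht ρ).2.1.symm.trans hπ.2.1)) rfl⟩
  calc M.pathExp 𝔖 f (n + 1) h s = ∑' π, F (g π) := tsum_congr fun π => by
        rw [← cons_tail π, probAux_cons (ht π), mul_assoc]
    _ = ∑' x, F x := hg.tsum_eq hsupp
    _ = _ := by
        rw [ENNReal.tsum_sigma']
        exact tsum_congr fun u => ENNReal.tsum_mul_left (a := M.P s (𝔖 h s) u)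
          (f := fun π : M.PathsEq n u => M.probAux 𝔖 (h ++ [s]) π * f (s :: π))

lemma pathExp_one {𝔖 : List M.S → M.S → M.A} (h𝔖 : M.IsSched 𝔖) (n : ℕ) (h : List M.S)
    (s : M.S) : M.pathExp 𝔖 (fun _ => 1) n h s = 1 := by
  induction n generalizing h s with
  | zero => rw [pathExp_zero]
  | succ n ih => simpa only [pathExp_succ h𝔖, ih, mul_one] using! h𝔖 h s

lemma pathExp_rewPath_succ {𝔖 : List M.S → M.S → M.A} (h𝔖 : M.IsSched 𝔖) (n : ℕ)
    (h : List M.S) (s : M.S) :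
    M.pathExp 𝔖 (rewPath rew) (n + 1) h s =
      rew s + ∑' t, M.P s (𝔖 h s) t * M.pathExp 𝔖 (rewPath rew) n (h ++ [s]) t := by
  have key (t : M.S) : M.pathExp 𝔖 (fun π => rewPath rew (s :: π)) n (h ++ [s]) t =
      rew s + M.pathExp 𝔖 (rewPath rew) n (h ++ [s]) t := by
    have hone := pathExp_one h𝔖 n (h ++ [s]) t
    simp only [pathExp, mul_one] at hone
    simp only [pathExp, rewPath, List.map_cons, List.sum_cons, mul_add]
    rw [ENNReal.tsum_add, ENNReal.tsum_mul_right, hone, one_mul]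
  have hsum : ∑' t, M.P s (𝔖 h s) t = 1 := h𝔖 h s
  simp only [pathExp_succ h𝔖, key, mul_add]
  rw [ENNReal.tsum_add, ENNReal.tsum_mul_right, hsum, one_mul]

lemma bellmanMin_mono : Monotone (M.bellmanMin rew) := fun _ _ hvw _ =>
  add_le_add_right (iInf_mono fun _ => ENNReal.tsum_le_tsum fun t => mul_le_mul_right (hvw t) _) _

lemma tsum_P_mul_iSup {v : ℕ → M.S → ℝ≥0∞} (hv : Monotone v) (s : M.S) (a : M.A) :
    ∑' t, M.P s a t * (⨆ n, v n) t = ⨆ n, ∑' t, M.P s a t * v n t := by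
  have hfin (w : M.S → ℝ≥0∞) :
      ∑' t, M.P s a t * w t = ∑ t ∈ (M.finite_supp s a).toFinset, M.P s a t * w t :=
    tsum_eq_sum fun t ht => by
      have : M.P s a t = 0 := by simpa using ht
      rw [this, zero_mul]
  rw [hfin]
  simp only [hfin, iSup_apply, ENNReal.mul_iSup]
  exact ENNReal.finsetSum_iSup_of_monotone fun t _ _ hmn => mul_le_mul_right (hv hmn t) _

lemma bellmanMin_iSup {v : ℕ → M.S → ℝ≥0∞} (hv : Monotone v) :
    M.bellmanMin rew (⨆ n, v n) = ⨆ n, M.bellmanMin rew (v n) := by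
  ext s
  rw [iSup_apply]
  simp only [bellmanMin, tsum_P_mul_iSup hv]
  rw [← ENNReal.add_iSup, iSup_iInf_of_monotone]
  exact fun a _ _ hmn => ENNReal.tsum_le_tsum fun t => mul_le_mul_right (hv hmn t) _

lemma bellmanMin_iSup_iterate :
    M.bellmanMin rew (⨆ n, (M.bellmanMin rew)^[n] 0) = ⨆ n, (M.bellmanMin rew)^[n] 0 := by
  have hmono : Monotone fun n => (M.bellmanMin rew)^[n] 0 :=
    (bellmanMin_mono rew).monotone_iterate_of_le_map (fun _ => zero_le)
  rw [bellmanMin_iSup rew hmono]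
  simp only [← Function.iterate_succ_apply']
  exact hmono.iSup_nat_add 1

lemma iterate_bellmanMin_le_pathExp {𝔖 : List M.S → M.S → M.A} (h𝔖 : M.IsSched 𝔖) (n : ℕ)
    (h : List M.S) (s : M.S) :
    (M.bellmanMin rew)^[n] 0 s ≤ M.pathExp 𝔖 (rewPath rew) n h s := by
  induction n generalizing h s with
  | zero => exact zero_le
  | succ n ih =>
    rw [Function.iterate_succ_apply', pathExp_rewPath_succ rew h𝔖]
    refine add_le_add_right ((iInf_le _ ⟨𝔖 h s, h𝔖 h s⟩).trans ?_) _
    exact ENNReal.tsum_le_tsum fun t => mul_le_mul_right (ih _ t) _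

lemma pathExp_le_of_forall_le {𝔖 : List M.S → M.S → M.A} (h𝔖 : M.IsSched 𝔖)
    {v : M.S → ℝ≥0∞} (hv : ∀ h s, rew s + ∑' t, M.P s (𝔖 h s) t * v t ≤ v s) (n : ℕ)
    (h : List M.S) (s : M.S) : M.pathExp 𝔖 (rewPath rew) n h s ≤ v s := by
  induction n generalizing h s with
  | zero =>
    rw [pathExp_zero]
    simpa [rewPath] using le_self_add.trans (hv h s)
  | succ n ih =>
    rw [pathExp_rewPath_succ rew h𝔖]
    refine le_trans ?_ (hv h s)
    exact add_le_add_right (ENNReal.tsum_le_tsum fun t => mul_le_mul_right (ih _ t) _) _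

end MDP

/-- There exists a memoryless scheduler `𝔖` that is uniformly
min-optimal for `M` with respect to `rew`: for every state `s`,
`ER_𝔖(rew, s) = MinER(rew, s)`. -/
theorem exists_memoryless_uniformly_min_optimal (M : MDP) (rew : M.S → ℝ≥0∞) :
    ∃ 𝔖 : List M.S → M.S → M.A, M.IsSched 𝔖 ∧ M.Memoryless 𝔖 ∧
      ∀ s, M.ER rew 𝔖 s = M.MinER rew s := by
  let v : M.S → ℝ≥0∞ := ⨆ n, (M.bellmanMin rew)^[n] 0
  choose a ha using fun s =>
    exists_eq_ciInf_of_finite (f := fun a : M.Act s => ∑' t, M.P s a.1 t * v t)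
  let 𝔖 : List M.S → M.S → M.A := fun _ s => (a s).1
  have h𝔖 : M.IsSched 𝔖 := fun _ s => (a s).2
  refine ⟨𝔖, h𝔖, fun _ _ _ => rfl, fun s => le_antisymm ?_ (iInf_le _ (⟨𝔖, h𝔖⟩ : M.Scheds))⟩
  have upper : M.ER rew 𝔖 s ≤ v s := iSup_le fun n =>
    MDP.pathExp_le_of_forall_le rew h𝔖
      (fun _ s => (congrArg (rew s + ·) (ha s)).trans_le
        (congrFun (MDP.bellmanMin_iSup_iterate rew) s).le) n [] s
  refine upper.trans (le_iInf fun 𝔗 => ?_)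
  simp only [v, iSup_apply]
  exact iSup_mono fun n => MDP.iterate_bellmanMin_le_pathExp rew 𝔗.2 n [] s
end
end

section
/- Let M = (S, Act, P) be an MDP and rew : S → [0,∞] a reward function for M. For every state s ∈ S, the minimal expected reward equals the minimum over memoryless schedulers, and this minimum is attained: MinER(rew, s) = min_{𝔖 ∈ MLScheds} ER_𝔖(rew, s), i.e. inf over all schedulers of ER_𝔖(rew,s) equals inf over memoryless schedulers of ER_𝔖(rew,s), and there is a memoryless scheduler attaining this value. -/
open scoped ENNReal

noncomputable section

namespace MDP

variable {M : MDP}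

/-- Lists of a fixed length are split into head and tail. -/
def listLengthSuccEquiv (α : Type*) (n : ℕ) :
    {l : List α // l.length = n + 1} ≃ α × {l : List α // l.length = n} where
  toFun l := (l.1.head (List.ne_nil_of_length_eq_add_one l.2),
    ⟨l.1.tail, by simp [l.2]⟩)
  invFun p := ⟨p.1 :: p.2.1, by simp [p.2.2]⟩
  left_inv l := by simp
  right_inv p := by simp

/-- Expected reward after `n` steps from `s`, given the history `h` of previously visited states,
as a sum over all state sequences. -/
def stepER (M : MDP) (rew : M.S → ℝ≥0∞) (𝔖 : List M.S → M.S → M.A) (n : ℕ) (h : List M.S)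
    (s : M.S) : ℝ≥0∞ :=
  ∑' l : {l : List M.S // l.length = n}, M.probAux 𝔖 h (s :: l.1) * rewPath rew (s :: l.1)

theorem tsum_list_length_succ {α : Type*} (n : ℕ) (f : List α → ℝ≥0∞) :
    ∑' l : {l : List α // l.length = n + 1}, f l.1 =
      ∑' a, ∑' l : {l : List α // l.length = n}, f (a :: l.1) := by
  rw [← (listLengthSuccEquiv α n).symm.tsum_eq, ENNReal.tsum_prod']
  rfl

theorem tsum_list_length_zero {α : Type*} (f : List α → ℝ≥0∞) :
    ∑' l : {l : List α // l.length = 0}, f l.1 = f [] := by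
  rw [tsum_eq_single ⟨[], rfl⟩]
  rintro ⟨l, hl⟩ hne
  exact absurd (Subtype.ext (List.length_eq_zero_iff.mp hl)) hne

theorem tsum_probAux_eq_one {𝔖 : List M.S → M.S → M.A} (h𝔖 : M.IsSched 𝔖) (n : ℕ)
    (h : List M.S) (s : M.S) :
    ∑' l : {l : List M.S // l.length = n}, M.probAux 𝔖 h (s :: l.1) = 1 := by
  induction n generalizing h s with
  | zero => rw [tsum_list_length_zero (fun l => M.probAux 𝔖 h (s :: l))]; rfl
  | succ n ih =>
    rw [tsum_list_length_succ n (fun l => M.probAux 𝔖 h (s :: l))]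
    simp only [probAux, ENNReal.tsum_mul_left, ih, mul_one]
    exact h𝔖 h s

theorem stepER_zero (rew : M.S → ℝ≥0∞) (𝔖 : List M.S → M.S → M.A) (h : List M.S) (s : M.S) :
    M.stepER rew 𝔖 0 h s = rew s := by
  rw [stepER, tsum_list_length_zero (fun l => M.probAux 𝔖 h (s :: l) * rewPath rew (s :: l))]
  simp [probAux, rewPath]

theorem stepER_succ (rew : M.S → ℝ≥0∞) {𝔖 : List M.S → M.S → M.A} (h𝔖 : M.IsSched 𝔖)
    (n : ℕ) (h : List M.S) (s : M.S) :
    M.stepER rew 𝔖 (n + 1) h s =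
      rew s + ∑' s', M.P s (𝔖 h s) s' * M.stepER rew 𝔖 n (h ++ [s]) s' := by
  have hP : ∑' s', M.P s (𝔖 h s) s' = 1 := h𝔖 h s
  have hrew (l : List M.S) : rewPath rew (s :: l) = rew s + rewPath rew l := by simp [rewPath]
  rw [stepER, tsum_list_length_succ n
    (fun l => M.probAux 𝔖 h (s :: l) * rewPath rew (s :: l))]
  simp only [hrew, probAux, mul_add, ENNReal.tsum_add, ENNReal.tsum_mul_right,
    ENNReal.tsum_mul_left, tsum_probAux_eq_one h𝔖, hP, one_mul, mul_assoc, stepER]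

theorem isPath_of_probAux_ne_zero {𝔖 : List M.S → M.S → M.A} (h𝔖 : M.IsSched 𝔖)
    (h : List M.S) (s : M.S) (l : List M.S) (hl : M.probAux 𝔖 h (s :: l) ≠ 0) :
    M.IsPath (s :: l) := by
  induction l generalizing h s with
  | nil => trivial
  | cons s' l ih =>
    have hmul := mul_ne_zero_iff.mp hl
    exact ⟨⟨_, h𝔖 h s, pos_iff_ne_zero.mpr hmul.1⟩, ih _ _ hmul.2⟩

theorem ERn_eq_stepER (rew : M.S → ℝ≥0∞) {𝔖 : List M.S → M.S → M.A} (h𝔖 : M.IsSched 𝔖)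
    (n : ℕ) (s : M.S) : M.ERn rew 𝔖 n s = M.stepER rew 𝔖 n [] s := by
  have cons_tail (π : M.PathsEq n s) : s :: π.1.tail = π.1 :=
    List.cons_head?_tail π.2.2.1
  let g (π : M.PathsEq n s) : {l : List M.S // l.length = n} :=
    ⟨π.1.tail, by simp [π.2.2.2]⟩
  have hg : Function.Injective g := by
    intro π ρ hπρ
    apply Subtype.ext
    rw [← cons_tail π, ← cons_tail ρ]
    exact congrArg (s :: ·) (congrArg Subtype.val hπρ)
  rw [stepER, ← hg.tsum_eq]
  · exact tsum_congr fun π => by simp only [g, cons_tail, pathProb]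
  · intro l hl
    have hpath := isPath_of_probAux_ne_zero h𝔖 [] s l.1 (left_ne_zero_of_mul hl)
    exact ⟨⟨s :: l.1, hpath, rfl, by simp [l.2]⟩, rfl⟩

theorem monotone_stepER (rew : M.S → ℝ≥0∞) {𝔖 : List M.S → M.S → M.A} (h𝔖 : M.IsSched 𝔖)
    (h : List M.S) (s : M.S) : Monotone fun n => M.stepER rew 𝔖 n h s := by
  refine monotone_nat_of_le_succ fun n => ?_
  induction n generalizing h s with
  | zero =>
    rw [stepER_zero, stepER_succ rew h𝔖]
    exact le_self_add
  | succ n ih =>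
    rw [stepER_succ rew h𝔖, stepER_succ rew h𝔖]
    gcongr
    exact ih _ _

theorem probAux_append (𝔖 : List M.S → M.S → M.A) (h k : List M.S) (s : M.S) (l : List M.S) :
    M.probAux (fun k => 𝔖 (h ++ k)) k (s :: l) = M.probAux 𝔖 (h ++ k) (s :: l) := by
  induction l generalizing k s with
  | nil => rfl
  | cons s' l ih => simp only [probAux, ih, List.append_assoc]

theorem MinER_le_iSup_stepER (rew : M.S → ℝ≥0∞) {𝔖 : List M.S → M.S → M.A}
    (h𝔖 : M.IsSched 𝔖) (h : List M.S) (s : M.S) :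
    M.MinER rew s ≤ ⨆ n, M.stepER rew 𝔖 n h s := by
  have hsched : M.IsSched fun k => 𝔖 (h ++ k) := fun k t => h𝔖 (h ++ k) t
  refine (iInf_le _ (⟨_, hsched⟩ : M.Scheds)).trans (iSup_mono fun n => ?_)
  simp only [ERn_eq_stepER rew hsched, stepER, probAux_append, List.append_nil, le_refl]

theorem bellmanMin_MinER_le (rew : M.S → ℝ≥0∞) (s : M.S) :
    M.bellmanMin rew (M.MinER rew) s ≤ M.MinER rew s := by
  refine le_iInf fun ⟨𝔖, h𝔖⟩ => ?_
  have hsum : ∑' s', M.P s (𝔖 [] s) s' * ⨆ n, M.stepER rew 𝔖 n [s] s' =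
      ⨆ n, ∑' s', M.P s (𝔖 [] s) s' * M.stepER rew 𝔖 n [s] s' := by
    simp only [ENNReal.mul_iSup]
    simp only [ENNReal.tsum_eq_iSup_sum]
    rw [iSup_comm]
    exact iSup_congr fun t => ENNReal.finsetSum_iSup_of_monotone fun s' m n hmn =>
      mul_le_mul_right (monotone_stepER rew h𝔖 [s] s' hmn) _
  calc M.bellmanMin rew (M.MinER rew) s
      ≤ rew s + ∑' s', M.P s (𝔖 [] s) s' * M.MinER rew s' :=
        add_le_add_right (iInf_le _ (⟨𝔖 [] s, h𝔖 [] s⟩ : M.Act s)) _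
    _ ≤ rew s + ∑' s', M.P s (𝔖 [] s) s' * ⨆ n, M.stepER rew 𝔖 n [s] s' := by
        gcongr with s'
        exact MinER_le_iSup_stepER rew h𝔖 [s] s'
    _ = ⨆ n, M.stepER rew 𝔖 (n + 1) [] s := by
        simp only [hsum, ENNReal.add_iSup, stepER_succ rew h𝔖, List.nil_append]
    _ ≤ M.ER rew 𝔖 s := by
        refine iSup_le fun n => ?_
        rw [← ERn_eq_stepER rew h𝔖]
        exact le_iSup (fun n => M.ERn rew 𝔖 n s) (n + 1)

theorem exists_memoryless_bellmanMin (M : MDP) (rew v : M.S → ℝ≥0∞) :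
    ∃ 𝔖 : List M.S → M.S → M.A, M.IsSched 𝔖 ∧ M.Memoryless 𝔖 ∧
      ∀ h s, rew s + ∑' s', M.P s (𝔖 h s) s' * v s' = M.bellmanMin rew v s := by
  have := M.finiteA
  have hmin (s : M.S) : ∃ a : M.Act s, ∑' s', M.P s a.1 s' * v s' =
      ⨅ a : M.Act s, ∑' s', M.P s a.1 s' * v s' := by
    have : Nonempty (M.Act s) := nonempty_subtype.mpr (M.exists_enabled s)
    exact exists_eq_ciInf_of_finite
  choose a ha using hmin
  exact ⟨fun _ s => (a s).1, fun _ s => (a s).2, fun _ _ _ => rfl,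
    fun _ s => congrArg (rew s + ·) (ha s)⟩

theorem ER_le_of_step_le (rew v : M.S → ℝ≥0∞) {𝔖 : List M.S → M.S → M.A}
    (h𝔖 : M.IsSched 𝔖)
    (hv : ∀ h s, rew s + ∑' s', M.P s (𝔖 h s) s' * v s' ≤ v s) (s : M.S) :
    M.ER rew 𝔖 s ≤ v s := by
  have hstep (n : ℕ) (h : List M.S) (s : M.S) : M.stepER rew 𝔖 n h s ≤ v s := by
    induction n generalizing h s with
    | zero =>
      rw [stepER_zero]
      exact le_self_add.trans (hv h s)
    | succ n ih =>
      rw [stepER_succ rew h𝔖]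
      refine le_trans ?_ (hv h s)
      gcongr
      exact ih _ _
  exact iSup_le fun n => (ERn_eq_stepER rew h𝔖 n s).trans_le (hstep n [] s)

end MDP

/-- For every state `s`, the minimal expected reward equals the
infimum over memoryless schedulers of the expected reward, and this infimum is
attained by some memoryless scheduler:
`MinER(rew, s) = min_{𝔖 ∈ MLScheds} ER_𝔖(rew, s)`. -/
theorem minER_eq_min_memoryless (M : MDP) (rew : M.S → ℝ≥0∞) (s : M.S) :
    (M.MinER rew s =
      ⨅ 𝔖 : {𝔖 : List M.S → M.S → M.A // M.IsSched 𝔖 ∧ M.Memoryless 𝔖},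
        M.ER rew 𝔖.1 s) ∧
    ∃ 𝔖 : List M.S → M.S → M.A, M.IsSched 𝔖 ∧ M.Memoryless 𝔖 ∧
      M.ER rew 𝔖 s = M.MinER rew s := by
  obtain ⟨𝔖, h𝔖, hmem, hbell⟩ := M.exists_memoryless_bellmanMin rew (M.MinER rew)
  have hle : M.ER rew 𝔖 s ≤ M.MinER rew s :=
    MDP.ER_le_of_step_le rew _ h𝔖
      (fun h t => (hbell h t).trans_le (MDP.bellmanMin_MinER_le rew t)) s
  refine ⟨le_antisymm ?_ ?_, 𝔖, h𝔖, hmem, le_antisymm hle ?_⟩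
  · exact le_iInf fun 𝔗 => iInf_le _ (⟨𝔗.1, 𝔗.2.1⟩ : M.Scheds)
  · exact (iInf_le _ ⟨𝔖, h𝔖, hmem⟩).trans hle
  · exact iInf_le _ (⟨𝔖, h𝔖⟩ : M.Scheds)
end
end
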